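/- There exists R ∈ ℕ, depending only on B and w₁, …, w_r, such that C¹ is generated as a right ℤ[F]-module by the set of its elements that are supported on the ball of radius R about the identity vertex e in T. -/

import Mathlib

open scoped BigOperators

namespace DecompPaper

variable (B : Type) [DecidableEq B]

/-- The set of letters `B ⊔ B⁻¹` carries the discrete topology. -/
instance : TopologicalSpace (B × Bool) := ⊥

/-- The Gromov boundary `∂F` of the free group on `B`: the space of infinite reduced
words, i.e. sequences of letters with no cancelling adjacent pair, topologized as a
subspace of the product of discrete spaces. -/
abbrev Boundary : Type :=
  {s : ℕ → B × Bool // ∀ k, s (k + 1) ≠ ((s k).1, !(s k).2)}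

/-- The prefix of length `m` of an infinite reduced word, as an element of the free group. -/
def prefixOf (ξ : Boundary B) (m : ℕ) : FreeGroup B :=
  FreeGroup.mk (List.ofFn fun i : Fin m => ξ.1 i)

/-- Adjacency in the Cayley graph `T` of the free group with respect to `B`. -/
def Adj (g h : FreeGroup B) : Prop :=
  ∃ x : B × Bool, h = g * FreeGroup.mk [x]

/-- A set of vertices of `T` is a subtree iff any two of its vertices are joined by a
path in the Cayley graph staying inside the set. -/
def IsSubtree (X : Set (FreeGroup B)) : Prop :=
  ∀ g ∈ X, ∀ h ∈ X, Relation.ReflTransGen (fun a b => Adj B a b ∧ b ∈ X) g h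

/-- `C` is a connected component of `T ∖ X`. -/
def IsComponentOf (X C : Set (FreeGroup B)) : Prop :=
  ∃ v, v ∉ X ∧
    C = {u | Relation.ReflTransGen (fun a b => Adj B a b ∧ a ∉ X ∧ b ∉ X) v u}

/-- `∂C`: the set of boundary points all of whose sufficiently long prefixes lie in `C`. -/
def boundaryOf (C : Set (FreeGroup B)) : Set (Boundary B) :=
  {ξ | ∃ m, ∀ k, m ≤ k → prefixOf B ξ k ∈ C}

/-- The sequence `a` of group elements converges to the boundary point `ξ`:
every prefix of `ξ` is eventually an initial segment of the reduced word of `a k`. -/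
def TendstoBoundary (a : ℕ → FreeGroup B) (ξ : Boundary B) : Prop :=
  ∀ m : ℕ, ∃ K, ∀ k, K ≤ k → (List.ofFn fun i : Fin m => ξ.1 i) <+: (a k).toWord

/-- `{ξ, η}` is a line of the line pattern generated by the words `w i`: for some
`g` and `i`, `ξ` and `η` are the limits of `g * (w i) ^ k` as `k → +∞` and `k → -∞`
(in one of the two orders). -/
def IsLine {r : ℕ} (w : Fin r → FreeGroup B) (ξ η : Boundary B) : Prop :=
  ∃ (g : FreeGroup B) (i : Fin r),
    (TendstoBoundary B (fun k => g * w i ^ k) ξ ∧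
       TendstoBoundary B (fun k => g * (w i)⁻¹ ^ k) η) ∨
    (TendstoBoundary B (fun k => g * w i ^ k) η ∧
       TendstoBoundary B (fun k => g * (w i)⁻¹ ^ k) ξ)

/-- Malnormality of the family of cyclic subgroups `⟨w i⟩`. -/
def Malnormal {r : ℕ} (w : Fin r → FreeGroup B) : Prop :=
  ∀ (g : FreeGroup B) (i j : Fin r),
    (∃ x : FreeGroup B, x ∈ Subgroup.zpowers (w i) ∧ x ≠ 1 ∧
        g * x * g⁻¹ ∈ Subgroup.zpowers (w j)) →
      i = j ∧ g ∈ Subgroup.zpowers (w i)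

/-- The decomposition space `D`: the quotient of `∂F` by the smallest equivalence
relation identifying the two endpoints of each line, with the quotient topology. -/
abbrev DSpace {r : ℕ} (w : Fin r → FreeGroup B) : Type :=
  Quot (IsLine B w)

/-- The quotient projection `q : ∂F → D`. -/
def qmap {r : ℕ} (w : Fin r → FreeGroup B) : Boundary B → DSpace B w :=
  Quot.mk _

/-- The geodesic of the line with endpoints `ξ` and `η`: all prefixes of `ξ` or of `η`
of length at least the length of their longest common initial segment. -/
def lineGeodesic (ξ η : Boundary B) : Set (FreeGroup B) :=
  {g | ∃ k : ℕ, (g = prefixOf B ξ k ∨ g = prefixOf B η k) ∧ ∃ i ≤ k, ξ.1 i ≠ η.1 i}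

/-- The line with endpoints `ξ, η` passes through the subtree `X`. -/
def PassesThrough (ξ η : Boundary B) (X : Set (FreeGroup B)) : Prop :=
  ∃ g ∈ X, g ∈ lineGeodesic B ξ η

/-- A function `σ : D → ℤ` is supported on the subtree `X` if `σ ∘ q` is constant on
`∂C` for every connected component `C` of `T ∖ X`. -/
def SupportedOn {r : ℕ} (w : Fin r → FreeGroup B) (σ : DSpace B w → ℤ)
    (X : Set (FreeGroup B)) : Prop :=
  ∀ C : Set (FreeGroup B), IsComponentOf B X C →
    ∀ ξ, ξ ∈ boundaryOf B C → ∀ η, η ∈ boundaryOf B C →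
      σ (qmap B w ξ) = σ (qmap B w η)

/-- Prepending a letter to an infinite reduced word, cancelling if necessary. -/
def consB (x : B × Bool) (ξ : Boundary B) : Boundary B :=
  if h : ξ.1 0 = (x.1, !x.2) then
    ⟨fun k => ξ.1 (k + 1), fun k => ξ.2 (k + 1)⟩
  else
    ⟨fun k => Nat.rec x (fun j _ => ξ.1 j) k, by
      intro k
      cases k with
      | zero => exact h
      | succ j => exact ξ.2 j⟩

/-- The action of the free group on its boundary: left multiplication followed by
reduction. -/
def actB (g : FreeGroup B) (ξ : Boundary B) : Boundary B :=
  g.toWord.foldr (consB B) ξ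

/-- The induced action of the free group on the decomposition space. -/
noncomputable def actD {r : ℕ} (w : Fin r → FreeGroup B) (g : FreeGroup B)
    (x : DSpace B w) : DSpace B w :=
  qmap B w (actB B g (Quot.out x))

/-- The map `p : (ℤ[F])^k → C(D, ℤ)` of right `ℤ[F]`-modules determined by generators
`σ j`, where an element of the free module `(ℤ[F])^k` is recorded as a finitely
supported function `(Fin k × F) →₀ ℤ` and `e_j · g` is sent to `σ j · g`. -/
noncomputable def pMap {r : ℕ} (w : Fin r → FreeGroup B) {k : ℕ}
    (σ : Fin k → DSpace B w → ℤ) (x : (Fin k × FreeGroup B) →₀ ℤ) :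
    DSpace B w → ℤ :=
  fun d => x.sum fun p n => n * σ p.1 (actD B w p.2 d)

/-- Right translation by `g` on the free module `(ℤ[F])^k`, sending `e_j · h` to
`e_j · (h * g)`. -/
noncomputable def fsTranslate {k : ℕ} (y : (Fin k × FreeGroup B) →₀ ℤ)
    (g : FreeGroup B) : (Fin k × FreeGroup B) →₀ ℤ :=
  Finsupp.mapDomain (fun p => (p.1, p.2 * g)) y

/-- The convex hull of a set of vertices of `T`: the smallest subtree containing it. -/
def hull (S : Set (FreeGroup B)) : Set (FreeGroup B) :=
  ⋂₀ {Y : Set (FreeGroup B) | IsSubtree B Y ∧ S ⊆ Y}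

/-- The support of an element of the free module `(ℤ[F])^k`, relative to supports
`X j` of the generators: the convex hull of the union of the sets `g⁻¹ • X j` over
the pairs `(j, g)` appearing with nonzero coefficient. -/
def fsSupport {k : ℕ} (X : Fin k → Set (FreeGroup B))
    (x : (Fin k × FreeGroup B) →₀ ℤ) : Set (FreeGroup B) :=
  hull B (⋃ p ∈ x.support, (fun v => p.2⁻¹ * v) '' X p.1)

/-- Antisymmetry of a `1`-cochain on oriented lines. -/
def Antisym {r : ℕ} (w : Fin r → FreeGroup B)
    (f : Boundary B → Boundary B → ℤ) : Prop :=
  ∀ ξ η, IsLine B w ξ η → f η ξ = -f ξ η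

/-- A `1`-cochain is supported on the subtree `X`: it vanishes on lines not passing
through `X`, and depends only on the pair of components of `T ∖ X` containing the two
endpoints. -/
def SupportedOn1 {r : ℕ} (w : Fin r → FreeGroup B)
    (f : Boundary B → Boundary B → ℤ) (X : Set (FreeGroup B)) : Prop :=
  (∀ ξ η, IsLine B w ξ η → ¬PassesThrough B ξ η X → f ξ η = 0) ∧
  (∀ C C' : Set (FreeGroup B), IsComponentOf B X C → IsComponentOf B X C' → C ≠ C' →
    ∀ ξ ξ' η η', IsLine B w ξ η → IsLine B w ξ' η' →
      ξ ∈ boundaryOf B C → ξ' ∈ boundaryOf B C →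
      η ∈ boundaryOf B C' → η' ∈ boundaryOf B C' →
      f ξ η = f ξ' η')

/-- Membership in `C¹`: an antisymmetric integer-valued function on oriented lines
supported on at least one finite nonempty subtree of `T`. -/
def MemC1 {r : ℕ} (w : Fin r → FreeGroup B)
    (f : Boundary B → Boundary B → ℤ) : Prop :=
  Antisym B w f ∧
    ∃ X : Set (FreeGroup B), X.Finite ∧ X.Nonempty ∧ IsSubtree B X ∧
      SupportedOn1 B w f X

/-- The ball of radius `R` about a set `Y` of vertices of `T` (word metric). -/
def ballAbout (Y : Set (FreeGroup B)) (R : ℕ) : Set (FreeGroup B) :=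
  {g | ∃ y ∈ Y, (y⁻¹ * g).toWord.length ≤ R}

/-- The map `p : (ℤ[F])^k → C¹` of right `ℤ[F]`-modules determined by generators
`f j`, sending `e_j · g` to `f j · g`. -/
noncomputable def pC1 {k : ℕ} (f : Fin k → Boundary B → Boundary B → ℤ)
    (x : (Fin k × FreeGroup B) →₀ ℤ) : Boundary B → Boundary B → ℤ :=
  fun ξ η => x.sum fun p n => n * f p.1 (actB B p.2 ξ) (actB B p.2 η)

/-- `σ : ∂F → ℤ` is constant on `∂C` for every connected component `C` of `T ∖ X`. -/
def ConstOnComponents (X : Set (FreeGroup B)) (σ : Boundary B → ℤ) : Prop :=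
  ∀ C : Set (FreeGroup B), IsComponentOf B X C →
    ∀ ξ, ξ ∈ boundaryOf B C → ∀ η, η ∈ boundaryOf B C → σ ξ = σ η

/-- The shadow `S(g) ⊆ ∂F` of a nontrivial group element `g`: the boundary points
having the reduced word of `g` as an initial segment. -/
def shadow (g : FreeGroup B) : Set (Boundary B) :=
  {ξ | prefixOf B ξ g.toWord.length = g}

end DecompPaper

open DecompPaper

namespace DecompPaper

section Helpers

variable {B : Type}

/-- The formal inverse of a letter. -/
def invLetter (x : B × Bool) : B × Bool := (x.1, !x.2)

@[simp]
theorem invLetter_invLetter (x : B × Bool) : invLetter (invLetter x) = x := by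
  simp [invLetter]

theorem ne_invLetter_iff {x y : B × Bool} : y ≠ invLetter x ↔ (x.1 = y.1 → x.2 = y.2) := by
  obtain ⟨a, b⟩ := x
  obtain ⟨c, d⟩ := y
  cases b <;> cases d <;> simp [invLetter, eq_comm]

/-- Two boundary points have the same initial segment of length `n`. -/
def Agree (n : ℕ) (ξ η : Boundary B) : Prop := ∀ i < n, ξ.1 i = η.1 i

theorem Agree.symm {n : ℕ} {ξ η : Boundary B} (h : Agree n ξ η) : Agree n η ξ :=
  fun i hi => (h i hi).symm

theorem Agree.trans {n : ℕ} {ξ η ζ : Boundary B} (h : Agree n ξ η) (h' : Agree n η ζ) :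
    Agree n ξ ζ :=
  fun i hi => (h i hi).trans (h' i hi)

theorem Agree.mono {m n : ℕ} {ξ η : Boundary B} (h : Agree n ξ η) (hmn : m ≤ n) :
    Agree m ξ η :=
  fun i hi => h i (hi.trans_le hmn)

/-- The infinite word obtained by deleting the first `m` letters. -/
def shift (m : ℕ) (ξ : Boundary B) : Boundary B :=
  ⟨fun k => ξ.1 (m + k), fun k => ξ.2 (m + k)⟩

theorem isReduced_ofFn (ξ : Boundary B) (m : ℕ) :
    FreeGroup.IsReduced (List.ofFn fun i : Fin m => ξ.1 i) := by
  rw [FreeGroup.IsReduced, List.isChain_iff_getElem]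
  intro i hi
  simp only [List.getElem_ofFn]
  exact ne_invLetter_iff.1 (ξ.2 i)

theorem ofFn_prefix_iff (ξ : Boundary B) (m : ℕ) (L : List (B × Bool)) :
    (List.ofFn fun i : Fin m => ξ.1 i) <+: L ↔ ∀ i < m, L[i]? = some (ξ.1 i) := by
  rw [List.prefix_iff_getElem?]
  simp

theorem prefixOf_congr {m : ℕ} {ξ η : Boundary B} (h : Agree m ξ η) :
    prefixOf B ξ m = prefixOf B η m := by
  unfold prefixOf
  congr 2
  funext i
  exact h i i.2

theorem head_invRev {L : List (B × Bool)} (hL : L ≠ []) (hL' : FreeGroup.invRev L ≠ []) :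
    (FreeGroup.invRev L).head hL' = invLetter (L.getLast hL) := by
  simp [FreeGroup.invRev, invLetter]

theorem getLast_invRev {L : List (B × Bool)} (hL : L ≠ []) (hL' : FreeGroup.invRev L ≠ []) :
    (FreeGroup.invRev L).getLast hL' = invLetter (L.head hL) := by
  simp [FreeGroup.invRev, invLetter]

variable [DecidableEq B]

theorem toWord_prefixOf (ξ : Boundary B) (m : ℕ) :
    (prefixOf B ξ m).toWord = List.ofFn fun i : Fin m => ξ.1 i :=
  (isReduced_ofFn ξ m).reduce_eq

theorem length_prefixOf (ξ : Boundary B) (m : ℕ) : (prefixOf B ξ m).toWord.length = m := by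
  simp [toWord_prefixOf]

theorem consB_of_eq {x : B × Bool} {ξ : Boundary B} (h : ξ.1 0 = invLetter x) (k : ℕ) :
    (consB B x ξ).1 k = ξ.1 (k + 1) := by
  rw [consB, dif_pos (show ξ.1 0 = (x.1, !x.2) from h)]

theorem consB_zero_of_ne {x : B × Bool} {ξ : Boundary B} (h : ξ.1 0 ≠ invLetter x) :
    (consB B x ξ).1 0 = x := by
  rw [consB, dif_neg (show ¬ ξ.1 0 = (x.1, !x.2) from h)]
  rfl

theorem consB_succ_of_ne {x : B × Bool} {ξ : Boundary B} (h : ξ.1 0 ≠ invLetter x) (k : ℕ) :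
    (consB B x ξ).1 (k + 1) = ξ.1 k := by
  rw [consB, dif_neg (show ¬ ξ.1 0 = (x.1, !x.2) from h)]

theorem consB_consB_invLetter (x : B × Bool) (ξ : Boundary B) :
    consB B x (consB B (invLetter x) ξ) = ξ := by
  apply Subtype.ext
  funext k
  by_cases h : ξ.1 0 = invLetter (invLetter x)
  · have h' : (consB B (invLetter x) ξ).1 0 ≠ invLetter x := by
      rw [consB_of_eq h]
      have := ξ.2 0
      rw [h, invLetter_invLetter] at this
      exact this
    cases k with
    | zero => rw [consB_zero_of_ne h', h, invLetter_invLetter]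
    | succ k => rw [consB_succ_of_ne h', consB_of_eq h]
  · rw [consB_of_eq (consB_zero_of_ne h), consB_succ_of_ne h]

/-- Prepending a generator, as a permutation of the boundary. -/
def consPerm (b : B) : Equiv.Perm (Boundary B) where
  toFun := consB B (b, true)
  invFun := consB B (b, false)
  left_inv := consB_consB_invLetter (b, false)
  right_inv := consB_consB_invLetter (b, true)

theorem foldr_consB_eq_lift (L : List (B × Bool)) (ξ : Boundary B) :
    L.foldr (consB B) ξ = FreeGroup.lift consPerm (FreeGroup.mk L) ξ := by
  rw [FreeGroup.lift_mk]
  induction L with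
  | nil => rfl
  | cons x L ih =>
    obtain ⟨b, s⟩ := x
    rw [List.foldr_cons, ih, List.map_cons, List.prod_cons, Equiv.Perm.mul_apply]
    cases s <;> rfl

theorem actB_eq_lift (g : FreeGroup B) (ξ : Boundary B) :
    actB B g ξ = FreeGroup.lift consPerm g ξ := by
  rw [actB, foldr_consB_eq_lift, FreeGroup.mk_toWord]

theorem actB_mul (g h : FreeGroup B) (ξ : Boundary B) :
    actB B (g * h) ξ = actB B g (actB B h ξ) := by
  simp [actB_eq_lift]

theorem actB_inv_eq_iff {g : FreeGroup B} {ξ η : Boundary B} :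
    actB B g⁻¹ ξ = η ↔ ξ = actB B g η := by
  simp [actB_eq_lift, Equiv.symm_apply_eq]

theorem foldr_consB_of_isReduced (L : List (B × Bool)) (ζ : Boundary B)
    (h : FreeGroup.IsReduced (L ++ [ζ.1 0])) :
    (∀ (i : ℕ) (hi : i < L.length), (L.foldr (consB B) ζ).1 i = L[i]) ∧
      ∀ i, (L.foldr (consB B) ζ).1 (L.length + i) = ζ.1 i := by
  induction L with
  | nil => simp
  | cons x L ih =>
    obtain ⟨ih₁, ih₂⟩ := ih (h.infix ⟨[x], [], by simp⟩)
    have hne : (L.foldr (consB B) ζ).1 0 ≠ invLetter x := by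
      rw [ne_invLetter_iff]
      cases L with
      | nil => exact (FreeGroup.isReduced_cons_cons.1 h).1
      | cons y L =>
        rw [ih₁ 0 (by simp)]
        exact (FreeGroup.isReduced_cons_cons.1 h).1
    refine ⟨fun i hi => ?_, fun i => ?_⟩
    · cases i with
      | zero => exact consB_zero_of_ne hne
      | succ i => simpa using (consB_succ_of_ne hne i).trans (ih₁ i (by simpa using hi))
    · rw [List.length_cons, Nat.add_right_comm]
      exact (consB_succ_of_ne hne _).trans (ih₂ i)

theorem actB_prefixOf {ξ ζ : Boundary B} {m : ℕ} (h : ζ.1 0 = ξ.1 m) :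
    (∀ i < m, (actB B (prefixOf B ξ m) ζ).1 i = ξ.1 i) ∧
      ∀ i, (actB B (prefixOf B ξ m) ζ).1 (m + i) = ζ.1 i := by
  have hred : FreeGroup.IsReduced ((List.ofFn fun i : Fin m => ξ.1 i) ++ [ζ.1 0]) := by
    have := isReduced_ofFn ξ (m + 1)
    rw [List.ofFn_succ_last] at this
    simpa [h] using this
  obtain ⟨h₁, h₂⟩ := foldr_consB_of_isReduced _ ζ hred
  rw [actB, toWord_prefixOf]
  refine ⟨fun i hi => ?_, fun i => ?_⟩
  · exact (h₁ i (by simpa using hi)).trans (List.getElem_ofFn _)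
  · simpa using h₂ i

theorem actB_prefixOf_shift (ξ : Boundary B) (m : ℕ) :
    actB B (prefixOf B ξ m) (shift m ξ) = ξ := by
  obtain ⟨h₁, h₂⟩ := actB_prefixOf (ξ := ξ) (ζ := shift m ξ) (m := m) rfl
  apply Subtype.ext
  funext i
  by_cases hi : i < m
  · exact h₁ i hi
  · obtain ⟨j, rfl⟩ := Nat.exists_eq_add_of_le (not_lt.1 hi)
    exact h₂ j

theorem actB_inv_prefixOf (ξ : Boundary B) (m : ℕ) :
    actB B (prefixOf B ξ m)⁻¹ ξ = shift m ξ :=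
  actB_inv_eq_iff.2 (actB_prefixOf_shift ξ m).symm

/-- Translating by the inverse of a common initial segment shortens agreement by its length. -/
theorem agree_actB_inv_prefixOf_iff {ξ ξ₀ : Boundary B} {m k : ℕ} (hk : 0 < k) :
    Agree k (actB B (prefixOf B ξ₀ m)⁻¹ ξ) (actB B (prefixOf B ξ₀ m)⁻¹ ξ₀) ↔
      Agree (m + k) ξ ξ₀ := by
  rw [actB_inv_prefixOf]
  constructor
  · intro h
    obtain ⟨ζ, hζ⟩ : ∃ ζ, actB B (prefixOf B ξ₀ m)⁻¹ ξ = ζ := ⟨_, rfl⟩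
    rw [hζ] at h
    rw [actB_inv_eq_iff.1 hζ]
    obtain ⟨h₁, h₂⟩ := actB_prefixOf (ξ := ξ₀) (ζ := ζ) (m := m) (h 0 hk)
    intro i hi
    by_cases him : i < m
    · exact h₁ i him
    · obtain ⟨j, rfl⟩ := Nat.exists_eq_add_of_le (not_lt.1 him)
      exact (h₂ j).trans (h j (by omega))
  · intro h
    rw [← prefixOf_congr (h.mono (Nat.le_add_right m k)), actB_inv_prefixOf]
    exact fun i hi => h (m + i) (by omega)

theorem tendstoBoundary_letter_mul (x : B × Bool) {a : ℕ → FreeGroup B} {ξ : Boundary B}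
    (h : TendstoBoundary B a ξ) :
    TendstoBoundary B (fun k => FreeGroup.mk [x] * a k) (consB B x ξ) := by
  intro m
  obtain ⟨K, hK⟩ := h (m + 1)
  refine ⟨K, fun k hk => ?_⟩
  have hp := (ofFn_prefix_iff _ _ _).1 (hK k hk)
  rw [ofFn_prefix_iff]
  have hw : (FreeGroup.mk [x] * a k).toWord = FreeGroup.reduce (x :: (a k).toWord) := by
    conv_lhs => rw [← FreeGroup.mk_toWord (x := a k), FreeGroup.mul_mk, FreeGroup.toWord_mk]
    rfl
  intro i hi
  rw [hw, FreeGroup.reduce.cons, FreeGroup.reduce_toWord]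
  cases hL : (a k).toWord with
  | nil => simpa [hL] using hp 0 (by omega)
  | cons y L =>
    rw [hL] at hp
    have hy : y = ξ.1 0 := by simpa using hp 0 (by omega)
    by_cases hc : ξ.1 0 = invLetter x
    · have hc' : x.1 = y.1 ∧ x.2 = !y.2 := by simp [hy, hc, invLetter]
      simp only [if_pos hc', consB_of_eq hc]
      simpa using hp (i + 1) (by omega)
    · have hc' : ¬ (x.1 = y.1 ∧ x.2 = !y.2) := by
        rintro ⟨h₁, h₂⟩
        exact hc (by rw [← hy]; ext <;> simp [invLetter, h₁, h₂])
      simp only [if_neg hc']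
      cases i with
      | zero => simp [consB_zero_of_ne hc]
      | succ i => simpa [consB_succ_of_ne hc] using hp i (by omega)

theorem tendstoBoundary_mul (g : FreeGroup B) {a : ℕ → FreeGroup B} {ξ : Boundary B}
    (h : TendstoBoundary B a ξ) :
    TendstoBoundary B (fun k => g * a k) (actB B g ξ) := by
  have key : ∀ L : List (B × Bool),
      TendstoBoundary B (fun k => FreeGroup.mk L * a k) (L.foldr (consB B) ξ) := by
    intro L
    induction L with
    | nil => simpa [← FreeGroup.one_eq_mk] using h
    | cons x L ih =>
      have := tendstoBoundary_letter_mul x ih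
      simpa only [← mul_assoc, FreeGroup.mul_mk, List.singleton_append, List.foldr_cons] using this
  simpa only [actB, FreeGroup.mk_toWord] using key g.toWord

theorem tendstoBoundary_unique {a : ℕ → FreeGroup B} {ξ η : Boundary B}
    (hξ : TendstoBoundary B a ξ) (hη : TendstoBoundary B a η) : ξ = η := by
  apply Subtype.ext
  funext i
  obtain ⟨K, hK⟩ := hξ (i + 1)
  obtain ⟨K', hK'⟩ := hη (i + 1)
  have h₁ := (ofFn_prefix_iff _ _ _).1 (hK (max K K') (le_max_left _ _)) i (Nat.lt_succ_self i)
  have h₂ := (ofFn_prefix_iff _ _ _).1 (hK' (max K K') (le_max_right _ _)) i (Nat.lt_succ_self i)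
  exact Option.some_injective _ (h₁.symm.trans h₂)

theorem actB_conj_eq_self {g w : FreeGroup B} {ξ : Boundary B}
    (h : TendstoBoundary B (fun k => g * w ^ k) ξ) : actB B (g * w * g⁻¹) ξ = ξ := by
  refine tendstoBoundary_unique (tendstoBoundary_mul (g * w * g⁻¹) h) fun m => ?_
  obtain ⟨K, hK⟩ := h m
  refine ⟨K, fun k hk => ?_⟩
  have : g * w * g⁻¹ * (g * w ^ k) = g * w ^ (k + 1) := by rw [pow_succ']; group
  rw [this]
  exact hK (k + 1) (by omega)

theorem IsLine.symm {r : ℕ} {w : Fin r → FreeGroup B} {ξ η : Boundary B}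
    (h : IsLine B w ξ η) : IsLine B w η ξ := by
  obtain ⟨g, i, h⟩ := h
  exact ⟨g, i, h.symm⟩

theorem IsLine.exists_conj_fixing {r : ℕ} {w : Fin r → FreeGroup B} {ξ η : Boundary B}
    (h : IsLine B w ξ η) :
    ∃ (g : FreeGroup B) (i : Fin r),
      actB B (g * w i * g⁻¹) ξ = ξ ∧ actB B (g * w i * g⁻¹) η = η := by
  have key : ∀ {g v : FreeGroup B} {ζ : Boundary B},
      TendstoBoundary B (fun k => g * v⁻¹ ^ k) ζ → actB B (g * v * g⁻¹) ζ = ζ := by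
    intro g v ζ hζ
    have := actB_conj_eq_self hζ
    rw [show g * v⁻¹ * g⁻¹ = (g * v * g⁻¹)⁻¹ by group, actB_inv_eq_iff] at this
    exact this.symm
  obtain ⟨g, i, ⟨h₁, h₂⟩ | ⟨h₁, h₂⟩⟩ := h
  · exact ⟨g, i, actB_conj_eq_self h₁, key h₂⟩
  · exact ⟨g, i, key h₂, actB_conj_eq_self h₁⟩

/-- A boundary point fixed by `y` either starts with the inverse of the last letter of `y`,
or is the periodic word spelled by `y`. -/
theorem periodic_of_actB_eq_self {y : FreeGroup B} (hy : y.toWord ≠ []) {ζ : Boundary B}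
    (hfix : actB B y ζ = ζ) (hlast : ζ.1 0 ≠ invLetter (y.toWord.getLast hy)) :
    ζ.1 0 = y.toWord.head hy ∧ ∀ i, ζ.1 (y.toWord.length + i) = ζ.1 i := by
  have hred : FreeGroup.IsReduced (y.toWord ++ [ζ.1 0]) := by
    rw [FreeGroup.IsReduced, List.isChain_append]
    refine ⟨FreeGroup.isReduced_toWord, List.isChain_singleton _, ?_⟩
    intro a ha b hb
    rw [List.getLast?_eq_some_getLast hy, Option.mem_some_iff] at ha
    rw [List.head?_cons, Option.mem_some_iff] at hb
    subst ha hb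
    exact ne_invLetter_iff.1 hlast
  obtain ⟨h₁, h₂⟩ := foldr_consB_of_isReduced _ ζ hred
  rw [show y.toWord.foldr (consB B) ζ = ζ from hfix] at h₁ h₂
  exact ⟨by rw [h₁ 0 (List.length_pos_iff.2 hy), List.head_eq_getElem], h₂⟩

/-- A nontrivial element fixing two boundary points with distinct first letters is cyclically
reduced, and these points are periodic with period its length. -/
theorem periodic_of_fixes_two {y : FreeGroup B} (hy : y.toWord ≠ []) {ζ ζ' : Boundary B}
    (hζ : actB B y ζ = ζ) (hζ' : actB B y ζ' = ζ') (hne : ζ.1 0 ≠ ζ'.1 0) :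
    FreeGroup.IsCyclicallyReduced y.toWord ∧ ∀ i, ζ.1 (y.toWord.length + i) = ζ.1 i := by
  have hinv : y⁻¹.toWord = FreeGroup.invRev y.toWord := FreeGroup.toWord_inv y
  have hy' : y⁻¹.toWord ≠ [] := by
    rw [Ne, FreeGroup.toWord_eq_nil_iff] at hy ⊢
    exact inv_ne_one.2 hy
  have dichotomy : ∀ {θ : Boundary B}, actB B y θ = θ →
      (θ.1 0 = invLetter (y.toWord.getLast hy) ∨
        θ.1 0 = y.toWord.head hy ∧ ∀ i, θ.1 (y.toWord.length + i) = θ.1 i) ∧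
      (θ.1 0 = y.toWord.head hy ∨
        θ.1 0 = invLetter (y.toWord.getLast hy) ∧
          ∀ i, θ.1 (y.toWord.length + i) = θ.1 i) := by
    intro θ hθ
    refine ⟨or_iff_not_imp_left.2 fun h => periodic_of_actB_eq_self hy hθ h,
      or_iff_not_imp_left.2 fun h => ?_⟩
    have hθ' : actB B y⁻¹ θ = θ := actB_inv_eq_iff.2 hθ.symm
    have := periodic_of_actB_eq_self hy' hθ'
    simp only [hinv, head_invRev hy, getLast_invRev hy, invLetter_invLetter,
      FreeGroup.invRev_length] at this
    exact this h
  have hcyc : y.toWord.head hy ≠ invLetter (y.toWord.getLast hy) := by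
    intro h
    have key : ∀ {θ : Boundary B}, actB B y θ = θ → θ.1 0 = y.toWord.head hy := by
      intro θ hθ
      rcases (dichotomy hθ).2 with h' | h'
      · exact h'
      · exact h'.1.trans h.symm
    exact hne ((key hζ).trans (key hζ').symm)
  refine ⟨⟨FreeGroup.isReduced_toWord, fun a ha b hb => ?_⟩, ?_⟩
  · rw [List.getLast?_eq_some_getLast hy, Option.mem_some_iff] at ha
    rw [List.head?_eq_some_head hy, Option.mem_some_iff] at hb
    subst ha hb
    exact ne_invLetter_iff.1 hcyc
  · obtain ⟨h₁ | h₁, h₂ | h₂⟩ := dichotomy hζ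
    · exact absurd (h₂.symm.trans h₁) hcyc
    · exact h₂.2
    · exact h₁.2
    · exact h₁.2

theorem norm_pow_of_isCyclicallyReduced {y : FreeGroup B}
    (hy : FreeGroup.IsCyclicallyReduced y.toWord) (k : ℕ) :
    (y ^ k).norm = k * y.norm := by
  rw [FreeGroup.norm, FreeGroup.toWord_pow, (hy.flatten_replicate k).isReduced.reduce_eq]
  simp [FreeGroup.norm]

theorem norm_pow_le (v : FreeGroup B) (k : ℕ) : (v ^ k).norm ≤ k * v.norm := by
  induction k with
  | zero => simp
  | succ k ih =>
    rw [pow_succ, Nat.succ_mul]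
    exact (FreeGroup.norm_mul_le _ _).trans (Nat.add_le_add_right ih _)

/-- A cyclically reduced element is of minimal length in its conjugacy class. -/
theorem norm_le_of_isCyclicallyReduced_conj {h v : FreeGroup B}
    (hy : FreeGroup.IsCyclicallyReduced (h * v * h⁻¹).toWord) :
    (h * v * h⁻¹).norm ≤ v.norm := by
  by_contra hlt
  have hk := norm_pow_of_isCyclicallyReduced hy (2 * h.norm + 1)
  have h₁ := FreeGroup.norm_mul_le (h * v ^ (2 * h.norm + 1)) h⁻¹
  have h₂ := FreeGroup.norm_mul_le h (v ^ (2 * h.norm + 1))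
  have h₃ := norm_pow_le v (2 * h.norm + 1)
  rw [conj_pow] at hk
  rw [FreeGroup.norm_inv_eq] at h₁
  have h₄ : (2 * h.norm + 1) * (v.norm + 1) ≤ (2 * h.norm + 1) * (h * v * h⁻¹).norm :=
    Nat.mul_le_mul_left _ (by omega)
  rw [Nat.mul_succ] at h₄
  omega

/-- A common period of all the lines. -/
def commonPeriod {r : ℕ} (w : Fin r → FreeGroup B) : ℕ := ∏ i, (w i).norm.factorial

theorem commonPeriod_pos {r : ℕ} (w : Fin r → FreeGroup B) : 0 < commonPeriod w :=
  Finset.prod_pos fun _ _ => Nat.factorial_pos _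

/-- After the branching point of its two ends, each end of a line is periodic. -/
theorem IsLine.periodic {r : ℕ} {w : Fin r → FreeGroup B} (hw : ∀ i, w i ≠ 1)
    {ξ η : Boundary B} (h : IsLine B w ξ η) {m : ℕ} (hm : Agree m ξ η)
    (hne : ξ.1 m ≠ η.1 m) (j : ℕ) :
    ξ.1 (m + (commonPeriod w + j)) = ξ.1 (m + j) := by
  obtain ⟨g, i, hξ, hη⟩ := h.exists_conj_fixing
  obtain ⟨p, hp⟩ : ∃ p, prefixOf B ξ m = p := ⟨_, rfl⟩
  have hp' : prefixOf B η m = p := (prefixOf_congr hm).symm.trans hp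
  have hfix : ∀ {ζ : Boundary B}, actB B (g * w i * g⁻¹) ζ = ζ → prefixOf B ζ m = p →
      actB B ((p⁻¹ * g) * w i * (p⁻¹ * g)⁻¹) (shift m ζ) = shift m ζ := by
    intro ζ hζ hζp
    have hs : actB B p (shift m ζ) = ζ := hζp ▸ actB_prefixOf_shift ζ m
    rw [show (p⁻¹ * g) * w i * (p⁻¹ * g)⁻¹ = p⁻¹ * ((g * w i * g⁻¹) * p) by group,
      actB_mul, actB_mul, hs, hζ, actB_inv_eq_iff, hs]
  have hy : ((p⁻¹ * g) * w i * (p⁻¹ * g)⁻¹).toWord ≠ [] := by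
    rw [Ne, FreeGroup.toWord_eq_nil_iff, conj_eq_one_iff]
    exact hw i
  obtain ⟨hcyc, hper⟩ := periodic_of_fixes_two hy (hfix hξ hp) (hfix hη hp') hne
  have hdvd : ((p⁻¹ * g) * w i * (p⁻¹ * g)⁻¹).toWord.length ∣ commonPeriod w :=
    (Nat.dvd_factorial (List.length_pos_iff.2 hy)
      (norm_le_of_isCyclicallyReduced_conj hcyc)).trans
      (Finset.dvd_prod_of_mem (fun i => (w i).norm.factorial) (Finset.mem_univ i))
  obtain ⟨c, hc⟩ := hdvd
  rw [hc]
  clear hc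
  change (shift m ξ).1 _ = (shift m ξ).1 _
  induction c with
  | zero => simp
  | succ c ih => rw [Nat.mul_succ, Nat.add_right_comm, Nat.add_comm, hper, ih]

/-- An end of a line is determined by a long enough segment after the branching point. -/
theorem IsLine.eq_of_agree {r : ℕ} {w : Fin r → FreeGroup B} (hw : ∀ i, w i ≠ 1)
    {ξ η ξ' η' : Boundary B} (h : IsLine B w ξ η) (h' : IsLine B w ξ' η') {m : ℕ}
    (hm : Agree m ξ η) (hne : ξ.1 m ≠ η.1 m)
    (hξ : Agree (m + commonPeriod w) ξ ξ') (hη : Agree (m + commonPeriod w) η η') :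
    ξ = ξ' := by
  have hN := commonPeriod_pos w
  have hm' : Agree m ξ' η' :=
    (hξ.mono (Nat.le_add_right _ _)).symm.trans (hm.trans (hη.mono (Nat.le_add_right _ _)))
  have hne' : ξ'.1 m ≠ η'.1 m := by
    rwa [← hξ m (by omega), ← hη m (by omega)]
  apply Subtype.ext
  funext i
  induction i using Nat.strong_induction_on with
  | _ i ih =>
    by_cases hi : i < m + commonPeriod w
    · exact hξ i hi
    · obtain ⟨j, rfl⟩ := Nat.exists_eq_add_of_le (not_lt.1 hi)
      rw [Nat.add_assoc, h.periodic hw hm hne, h'.periodic hw hm' hne']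
      exact ih (m + j) (by omega)

theorem toWord_mul_letter (a : FreeGroup B) (y : B × Bool) :
    (a * FreeGroup.mk [y]).toWord = a.toWord ++ [y] ∨
      a.toWord = (a * FreeGroup.mk [y]).toWord ++ [invLetter y] := by
  have hred : FreeGroup.IsReduced a.toWord := FreeGroup.isReduced_toWord
  have hmul : a * FreeGroup.mk [y] = FreeGroup.mk (a.toWord ++ [y]) := by
    rw [← FreeGroup.mul_mk, FreeGroup.mk_toWord]
  by_cases hlast : ∃ L, a.toWord = L ++ [invLetter y]
  · obtain ⟨L, hL⟩ := hlast
    right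
    have hb : a * FreeGroup.mk [y] = FreeGroup.mk L := by
      rw [hmul, hL, List.append_assoc, ← FreeGroup.mul_mk]
      have : FreeGroup.mk ([invLetter y] ++ [y]) = 1 := by
        rw [FreeGroup.one_eq_mk]
        exact Quot.sound (FreeGroup.Red.Step.not_rev (L₁ := []) (L₂ := []))
      rw [this, mul_one]
    rw [hL] at hred
    rw [hb, FreeGroup.toWord_mk, (hred.infix ⟨[], [_], rfl⟩).reduce_eq, hL]
  · left
    rw [hmul, FreeGroup.toWord_mk]
    apply FreeGroup.IsReduced.reduce_eq
    rw [FreeGroup.IsReduced, List.isChain_append]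
    refine ⟨hred, List.isChain_singleton _, fun u hu v hv => ?_⟩
    rw [List.head?_cons, Option.mem_some_iff] at hv
    subst hv
    apply ne_invLetter_iff.1
    rintro rfl
    obtain ⟨L, hL⟩ := List.getLast?_eq_some_iff.1 hu
    exact hlast ⟨L, by rw [hL, invLetter_invLetter]⟩

/-- A path in the complement of `X` cannot leave the branch at `g ∈ X` in direction `x`. -/
theorem prefix_of_reflTransGen {X : Set (FreeGroup B)} {g u v : FreeGroup B} {x : B × Bool}
    (hg : g ∈ X) (h : Relation.ReflTransGen (fun a b => Adj B a b ∧ a ∉ X ∧ b ∉ X) v u)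
    (hv : g.toWord ++ [x] <+: v.toWord) : g.toWord ++ [x] <+: u.toWord := by
  induction h with
  | refl => exact hv
  | @tail a b _ hab ih =>
    obtain ⟨⟨y, rfl⟩, -, hb⟩ := hab
    rcases toWord_mul_letter a y with h | h
    · rw [h]
      exact ih.trans (List.prefix_append _ _)
    · rw [h, List.prefix_concat_iff] at ih
      rcases ih with h' | h'
      · have := FreeGroup.toWord_injective (List.append_inj_left' h' rfl)
        exact absurd (this ▸ hg) hb
      · exact h'

theorem mem_ballAbout_one {g : FreeGroup B} {R : ℕ} :
    g ∈ ballAbout B {(1 : FreeGroup B)} R ↔ g.toWord.length ≤ R := by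
  simp [ballAbout]

/-- Boundary points in the same component of the complement of a ball agree beyond the ball. -/
theorem agree_of_mem_boundaryOf_ball {R : ℕ} {C : Set (FreeGroup B)}
    (hC : IsComponentOf B (ballAbout B {(1 : FreeGroup B)} R) C) {ξ ξ' : Boundary B}
    (hξ : ξ ∈ boundaryOf B C) (hξ' : ξ' ∈ boundaryOf B C) : Agree (R + 1) ξ ξ' := by
  obtain ⟨v, hv, rfl⟩ := hC
  rw [mem_ballAbout_one, not_le] at hv
  have htake : v.toWord.take R ++ [v.toWord[R]] = v.toWord.take (R + 1) :=
    (List.take_succ_eq_append_getElem hv).symm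
  have hword : (FreeGroup.mk (v.toWord.take R)).toWord = v.toWord.take R :=
    (FreeGroup.isReduced_toWord.infix (List.take_prefix R v.toWord).isInfix).reduce_eq
  have hmem : FreeGroup.mk (v.toWord.take R) ∈ ballAbout B {(1 : FreeGroup B)} R := by
    rw [mem_ballAbout_one, hword]
    exact List.length_take_le _ _
  have key : ∀ ζ ∈ boundaryOf B {u | Relation.ReflTransGen (fun a b => Adj B a b ∧
      a ∉ ballAbout B {(1 : FreeGroup B)} R ∧ b ∉ ballAbout B {(1 : FreeGroup B)} R) v u},
      ∀ i < R + 1, v.toWord[i]? = some (ζ.1 i) := by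
    rintro ζ ⟨m, hm⟩ i hi
    have hp := prefix_of_reflTransGen hmem (hm (m + (R + 1)) (by omega))
      (x := v.toWord[R]) (by rw [hword, htake]; exact List.take_prefix _ _)
    rw [hword, htake, toWord_prefixOf, List.prefix_iff_getElem?] at hp
    have hi' : i < (v.toWord.take (R + 1)).length := by
      rw [List.length_take]
      omega
    have := hp i hi'
    rw [List.getElem?_ofFn, dif_pos (by omega), List.getElem_take] at this
    rw [List.getElem?_eq_getElem (by omega)]
    exact this.symm
  intro i hi
  exact Option.some_injective _ ((key ξ hξ i hi).symm.trans (key ξ' hξ' i hi))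

theorem agree_of_not_passesThrough_ball {R : ℕ} {ξ η : Boundary B}
    (h : ¬PassesThrough B ξ η (ballAbout B {(1 : FreeGroup B)} R)) : Agree (R + 1) ξ η := by
  intro i hi
  by_contra hne
  refine h ⟨prefixOf B ξ i, ?_, i, Or.inl rfl, i, le_rfl, hne⟩
  rw [mem_ballAbout_one, length_prefixOf]
  omega

theorem not_passesThrough_of_agree {X : Set (FreeGroup B)} {n : ℕ}
    (hX : ∀ g ∈ X, g.toWord.length < n) {ξ η : Boundary B} (h : Agree n ξ η) :
    ¬PassesThrough B ξ η X := by
  rintro ⟨g, hg, k, hk, i, hik, hne⟩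
  have hlen := hX g hg
  have : g.toWord.length = k := by
    rcases hk with rfl | rfl <;> exact length_prefixOf _ _
  exact hne (h i (by omega))

/-- Outside of `X`, the tail of an infinite word stays in one component. -/
theorem mem_boundaryOf_component {X : Set (FreeGroup B)} {n : ℕ}
    (hX : ∀ g ∈ X, g.toWord.length < n) (ξ : Boundary B) :
    ξ ∈ boundaryOf B {u | Relation.ReflTransGen
      (fun a b => Adj B a b ∧ a ∉ X ∧ b ∉ X) (prefixOf B ξ n) u} := by
  have hnot : ∀ k, n ≤ k → prefixOf B ξ k ∉ X := by
    intro k hk hmem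
    have := hX _ hmem
    rw [length_prefixOf] at this
    omega
  refine ⟨n, fun k hk => ?_⟩
  induction k, hk using Nat.le_induction with
  | base => exact Relation.ReflTransGen.refl
  | succ k hk ih =>
    refine Relation.ReflTransGen.tail ih ⟨⟨ξ.1 k, ?_⟩, hnot k hk, hnot (k + 1) (by omega)⟩
    rw [prefixOf, prefixOf, FreeGroup.mul_mk, List.ofFn_succ_last]
    rfl

theorem isComponentOf_prefixOf {X : Set (FreeGroup B)} {n : ℕ}
    (hX : ∀ g ∈ X, g.toWord.length < n) (ξ : Boundary B) :
    IsComponentOf B X {u | Relation.ReflTransGen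
      (fun a b => Adj B a b ∧ a ∉ X ∧ b ∉ X) (prefixOf B ξ n) u} := by
  refine ⟨prefixOf B ξ n, fun hmem => ?_, rfl⟩
  have := hX _ hmem
  rw [length_prefixOf] at this
  omega

/-- A line whose ends lie in the same component of the complement of `X` avoids `X`. -/
theorem not_passesThrough_of_reflTransGen {X : Set (FreeGroup B)} {n : ℕ}
    (hX : ∀ g ∈ X, g.toWord.length < n) {ξ η : Boundary B}
    (h : Relation.ReflTransGen (fun a b => Adj B a b ∧ a ∉ X ∧ b ∉ X)
      (prefixOf B ξ n) (prefixOf B η n))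
    (h' : Relation.ReflTransGen (fun a b => Adj B a b ∧ a ∉ X ∧ b ∉ X)
      (prefixOf B η n) (prefixOf B ξ n)) :
    ¬PassesThrough B ξ η X := by
  have key : ∀ {ξ η : Boundary B} {k i : ℕ},
      Relation.ReflTransGen (fun a b => Adj B a b ∧ a ∉ X ∧ b ∉ X)
        (prefixOf B ξ n) (prefixOf B η n) →
      prefixOf B ξ k ∈ X → i ≤ k → ξ.1 i = η.1 i := by
    intro ξ η k i h hk hik
    have hkn := hX _ hk
    rw [length_prefixOf] at hkn
    have hsucc : (prefixOf B ξ k).toWord ++ [ξ.1 k] =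
        List.ofFn fun i : Fin (k + 1) => ξ.1 i := by
      rw [toWord_prefixOf, List.ofFn_succ_last]
      rfl
    have hp := prefix_of_reflTransGen (x := ξ.1 k) hk h (by
      rw [hsucc, ofFn_prefix_iff, toWord_prefixOf]
      intro j hj
      rw [List.getElem?_ofFn, dif_pos (by omega)])
    rw [hsucc, ofFn_prefix_iff, toWord_prefixOf] at hp
    have := hp i (by omega)
    rw [List.getElem?_ofFn, dif_pos (by omega)] at this
    exact (Option.some_injective _ this).symm
  rintro ⟨g, hg, k, rfl | rfl, i, hik, hne⟩
  · exact hne (key h hg hik)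
  · exact hne (key h' hg hik).symm

/-- A supported cochain only depends on sufficiently long initial segments. -/
theorem SupportedOn1.eq_of_agree {r : ℕ} {w : Fin r → FreeGroup B}
    {f : Boundary B → Boundary B → ℤ} {X : Set (FreeGroup B)} (hf : SupportedOn1 B w f X)
    {n : ℕ} (hX : ∀ g ∈ X, g.toWord.length < n) {ξ η ξ' η' : Boundary B}
    (h : IsLine B w ξ η) (h' : IsLine B w ξ' η') (hξ : Agree n ξ ξ') (hη : Agree n η η') :
    f ξ η = f ξ' η' := by
  have hmem' : ξ' ∈ boundaryOf B {u | Relation.ReflTransGen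
      (fun a b => Adj B a b ∧ a ∉ X ∧ b ∉ X) (prefixOf B ξ n) u} := by
    rw [prefixOf_congr hξ]
    exact mem_boundaryOf_component hX ξ'
  have hmem'' : η' ∈ boundaryOf B {u | Relation.ReflTransGen
      (fun a b => Adj B a b ∧ a ∉ X ∧ b ∉ X) (prefixOf B η n) u} := by
    rw [prefixOf_congr hη]
    exact mem_boundaryOf_component hX η'
  by_cases hC : {u | Relation.ReflTransGen
      (fun a b => Adj B a b ∧ a ∉ X ∧ b ∉ X) (prefixOf B ξ n) u} =
      {u | Relation.ReflTransGen
        (fun a b => Adj B a b ∧ a ∉ X ∧ b ∉ X) (prefixOf B η n) u}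
  · have h₁ : Relation.ReflTransGen (fun a b => Adj B a b ∧ a ∉ X ∧ b ∉ X)
        (prefixOf B ξ n) (prefixOf B η n) :=
      (Set.ext_iff.1 hC (prefixOf B η n)).2 Relation.ReflTransGen.refl
    have h₂ : Relation.ReflTransGen (fun a b => Adj B a b ∧ a ∉ X ∧ b ∉ X)
        (prefixOf B η n) (prefixOf B ξ n) :=
      (Set.ext_iff.1 hC (prefixOf B ξ n)).1 Relation.ReflTransGen.refl
    rw [hf.1 ξ η h (not_passesThrough_of_reflTransGen hX h₁ h₂), hf.1 ξ' η' h']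
    rw [prefixOf_congr hξ, prefixOf_congr hη] at h₁ h₂
    exact not_passesThrough_of_reflTransGen hX h₁ h₂
  · exact hf.2 _ _ (isComponentOf_prefixOf hX ξ) (isComponentOf_prefixOf hX η) hC
      ξ ξ' η η' h h' (mem_boundaryOf_component hX ξ) hmem'
      (mem_boundaryOf_component hX η) hmem''

open Classical in
/-- The elementary cochain counting, with sign, the lines whose ends have the same initial
segments of length `n` as `ξ₀` and `η₀`. -/
noncomputable def pairCochain (n : ℕ) (ξ₀ η₀ ξ η : Boundary B) : ℤ :=
  (if Agree n ξ ξ₀ ∧ Agree n η η₀ then 1 else 0) -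
    (if Agree n η ξ₀ ∧ Agree n ξ η₀ then 1 else 0)

theorem antisym_pairCochain {r : ℕ} (w : Fin r → FreeGroup B) (n : ℕ) (ξ₀ η₀ : Boundary B) :
    Antisym B w (pairCochain n ξ₀ η₀) := by
  intro ξ η _
  simp only [pairCochain, neg_sub]

theorem supportedOn1_pairCochain {r : ℕ} (w : Fin r → FreeGroup B) {k R : ℕ} (hk : 0 < k)
    (hkR : k ≤ R + 1) {ξ₀ η₀ : Boundary B} (hne : ξ₀.1 0 ≠ η₀.1 0) :
    SupportedOn1 B w (pairCochain k ξ₀ η₀) (ballAbout B {(1 : FreeGroup B)} R) := by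
  constructor
  · intro ξ η _ hpass
    have hag := agree_of_not_passesThrough_ball hpass 0 (by omega)
    rw [pairCochain, if_neg, if_neg, sub_zero]
    · rintro ⟨h₁, h₂⟩
      exact hne ((h₁ 0 hk).symm.trans (hag.symm.trans (h₂ 0 hk)))
    · rintro ⟨h₁, h₂⟩
      exact hne ((h₁ 0 hk).symm.trans (hag.trans (h₂ 0 hk)))
  · intro C C' hC hC' _ ξ ξ' η η' _ _ hξ hξ' hη hη'
    have h₁ := (agree_of_mem_boundaryOf_ball hC hξ hξ').mono hkR
    have h₂ := (agree_of_mem_boundaryOf_ball hC' hη hη').mono hkR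
    have key : ∀ {ζ ζ' : Boundary B}, Agree k ζ ζ' → ∀ θ, Agree k ζ θ = Agree k ζ' θ :=
      fun h _ => propext ⟨h.symm.trans, h.trans⟩
    simp only [pairCochain]
    rw [key h₁ ξ₀, key h₂ η₀, key h₂ ξ₀, key h₁ η₀]

/-- On lines, every elementary cochain of a line is a translate of one supported on a ball
of uniform radius. -/
theorem exists_ball_supported_translate {r : ℕ} {w : Fin r → FreeGroup B}
    (hw : ∀ i, w i ≠ 1) {n : ℕ} {ξ₀ η₀ : Boundary B} (h₀ : IsLine B w ξ₀ η₀)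
    (hne : ¬Agree n ξ₀ η₀) :
    ∃ (g : FreeGroup B) (F : Boundary B → Boundary B → ℤ), Antisym B w F ∧
      SupportedOn1 B w F (ballAbout B {(1 : FreeGroup B)} (commonPeriod w)) ∧
      ∀ ξ η, IsLine B w ξ η → F (actB B g ξ) (actB B g η) = pairCochain n ξ₀ η₀ ξ η := by
  classical
  have hex : ∃ m, m < n ∧ ξ₀.1 m ≠ η₀.1 m := by
    simpa [Agree] using hne
  obtain ⟨m, ⟨hmn, hm⟩, hmin⟩ : ∃ m, (m < n ∧ ξ₀.1 m ≠ η₀.1 m) ∧ Agree m ξ₀ η₀ :=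
    ⟨Nat.find hex, Nat.find_spec hex, fun i hi => by
      by_contra h
      exact Nat.find_min hex hi ⟨hi.trans (Nat.find_spec hex).1, h⟩⟩
  have hN := commonPeriod_pos w
  obtain ⟨k, hk⟩ : ∃ k, k = min (n - m) (commonPeriod w) := ⟨_, rfl⟩
  have hk0 : 0 < k := by omega
  refine ⟨(prefixOf B ξ₀ m)⁻¹, pairCochain k (actB B (prefixOf B ξ₀ m)⁻¹ ξ₀)
    (actB B (prefixOf B ξ₀ m)⁻¹ η₀), antisym_pairCochain w _ _ _,
    supportedOn1_pairCochain w hk0 (by omega) ?_, ?_⟩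
  · rw [actB_inv_prefixOf, prefixOf_congr hmin, actB_inv_prefixOf]
    exact hm
  · have hiff₁ : ∀ ξ, Agree k (actB B (prefixOf B ξ₀ m)⁻¹ ξ)
        (actB B (prefixOf B ξ₀ m)⁻¹ ξ₀) ↔ Agree (m + k) ξ ξ₀ :=
      fun ξ => agree_actB_inv_prefixOf_iff hk0
    have hiff₂ : ∀ ξ, Agree k (actB B (prefixOf B ξ₀ m)⁻¹ ξ)
        (actB B (prefixOf B ξ₀ m)⁻¹ η₀) ↔ Agree (m + k) ξ η₀ := by
      intro ξ
      rw [prefixOf_congr hmin]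
      exact agree_actB_inv_prefixOf_iff hk0
    have key : ∀ ξ η, IsLine B w ξ η →
        (Agree (m + k) ξ ξ₀ ∧ Agree (m + k) η η₀ ↔ Agree n ξ ξ₀ ∧ Agree n η η₀) := by
      intro ξ η h
      refine ⟨fun ⟨h₁, h₂⟩ => ?_, fun ⟨h₁, h₂⟩ => ⟨h₁.mono (by omega), h₂.mono (by omega)⟩⟩
      by_cases hle : n ≤ m + k
      · exact ⟨h₁.mono hle, h₂.mono hle⟩
      · obtain rfl : k = commonPeriod w := by omega
        rw [← h₀.eq_of_agree hw h hmin hm h₁.symm h₂.symm,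
          ← h₀.symm.eq_of_agree hw h.symm hmin.symm hm.symm h₂.symm h₁.symm]
        exact ⟨fun _ _ => rfl, fun _ _ => rfl⟩
    intro ξ η h
    simp only [pairCochain, hiff₁, hiff₂, key ξ η h, key η ξ h.symm]

theorem exists_length_lt_of_finite {X : Set (FreeGroup B)} (hX : X.Finite) :
    ∃ n, ∀ g ∈ X, g.toWord.length < n := by
  obtain ⟨n, hn⟩ := (hX.image fun g => g.toWord.length).bddAbove
  exact ⟨n + 1, fun g hg => Nat.lt_succ_of_le (hn ⟨g, hg, rfl⟩)⟩

end Helpers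

end DecompPaper

/-- there is `R`, depending only on `B` and the words `w i`, such
that `C¹` is generated as a right `ℤ[F]`-module by its elements supported on the ball
of radius `R` about the identity vertex `e` of `T`. -/
theorem first_cochains_generated_by_ball_supported_elements
    (B : Type) [Fintype B] [DecidableEq B] (hB : 2 ≤ Fintype.card B)
    (r : ℕ) (w : Fin r → FreeGroup B) (hw : ∀ i, w i ≠ 1) (hmal : Malnormal B w) :
    ∃ R : ℕ, ∀ f : Boundary B → Boundary B → ℤ, MemC1 B w f →
      ∃ (m : ℕ) (c : Fin m → ℤ) (g : Fin m → FreeGroup B)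
        (F : Fin m → Boundary B → Boundary B → ℤ),
        (∀ i, Antisym B w (F i)) ∧
        (∀ i, SupportedOn1 B w (F i) (ballAbout B {(1 : FreeGroup B)} R)) ∧
        ∀ ξ η, IsLine B w ξ η →
          f ξ η = ∑ i, c i * F i (actB B (g i) ξ) (actB B (g i) η) := by
  classical
  refine ⟨commonPeriod w, ?_⟩
  rintro f ⟨hanti, X, hfin, -, -, hsupp⟩
  obtain ⟨n, hn⟩ := exists_length_lt_of_finite hfin
  let ρ : Boundary B → (Fin n → B × Bool) := fun ξ i => ξ.1 i
  have hρ : ∀ {ξ η : Boundary B}, ρ ξ = ρ η ↔ Agree n ξ η :=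
    fun {ξ η} => ⟨fun h i hi => congrFun h ⟨i, hi⟩, fun h => funext fun i => h i i.2⟩
  let e := Fintype.equivFin (Fin n → B × Bool)
  have hterm : ∀ p : (Fin n → B × Bool) × (Fin n → B × Bool),
      ∃ (c : ℤ) (g : FreeGroup B) (F : Boundary B → Boundary B → ℤ), Antisym B w F ∧
        SupportedOn1 B w F (ballAbout B {(1 : FreeGroup B)} (commonPeriod w)) ∧
        ∀ ξ η, IsLine B w ξ η → c * F (actB B g ξ) (actB B g η) =
          (if p = (ρ ξ, ρ η) then if e (ρ ξ) < e (ρ η) then f ξ η else 0 else 0) -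
          (if p = (ρ η, ρ ξ) then if e (ρ η) < e (ρ ξ) then f η ξ else 0 else 0) := by
    rintro ⟨a, b⟩
    by_cases hex : ∃ ξ₀ η₀, IsLine B w ξ₀ η₀ ∧ ρ ξ₀ = a ∧ ρ η₀ = b ∧ e a < e b
    · obtain ⟨ξ₀, η₀, h₀, rfl, rfl, hlt⟩ := hex
      have hne : ¬Agree n ξ₀ η₀ := fun h => by
        rw [hρ.2 h] at hlt
        exact lt_irrefl _ hlt
      obtain ⟨g, F, hF, hF', hgF⟩ := exists_ball_supported_translate hw h₀ hne
      refine ⟨f ξ₀ η₀, g, F, hF, hF', fun ξ η h => ?_⟩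
      have key : ∀ {ζ θ : Boundary B}, IsLine B w ζ θ →
          (if (ρ ξ₀, ρ η₀) = (ρ ζ, ρ θ) then if e (ρ ζ) < e (ρ θ) then f ζ θ else 0 else 0) =
            f ξ₀ η₀ * if Agree n ζ ξ₀ ∧ Agree n θ η₀ then 1 else 0 := by
        intro ζ θ hζθ
        by_cases hc : Agree n ζ ξ₀ ∧ Agree n θ η₀
        · have h₁ := hρ.2 hc.1
          have h₂ := hρ.2 hc.2
          rw [if_pos (by rw [h₁, h₂]), if_pos (by rwa [h₁, h₂]), if_pos hc, mul_one]
          exact hsupp.eq_of_agree hn hζθ h₀ hc.1 hc.2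
        · rw [if_neg hc, if_neg, mul_zero]
          intro heq
          rw [Prod.mk.injEq] at heq
          exact hc ⟨hρ.1 heq.1.symm, hρ.1 heq.2.symm⟩
      rw [hgF ξ η h, pairCochain, key h, key h.symm, mul_sub]
    · refine ⟨0, 1, fun _ _ => 0, fun _ _ _ => rfl, ⟨fun _ _ _ _ => rfl, ?_⟩, ?_⟩
      · intros
        rfl
      · have key : ∀ {ζ θ : Boundary B}, IsLine B w ζ θ →
            (if (a, b) = (ρ ζ, ρ θ) then if e (ρ ζ) < e (ρ θ) then f ζ θ else 0 else 0) = 0 := by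
          intro ζ θ hζθ
          refine ite_eq_right_iff.2 fun heq => ite_eq_right_iff.2 fun hlt => ?_
          rw [Prod.mk.injEq] at heq
          exact absurd ⟨ζ, θ, hζθ, heq.1.symm, heq.2.symm, by rwa [heq.1, heq.2]⟩ hex
        intro ξ η h
        rw [key h, key h.symm, zero_mul, sub_zero]
  choose c g F hF hF' hsum using hterm
  let e' := Fintype.equivFin ((Fin n → B × Bool) × (Fin n → B × Bool))
  refine ⟨_, fun i => c (e'.symm i), fun i => g (e'.symm i), fun i => F (e'.symm i),
    fun i => hF _, fun i => hF' _, fun ξ η h => ?_⟩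
  rw [Equiv.sum_comp e'.symm fun p => c p * F p (actB B (g p) ξ) (actB B (g p) η),
    Finset.sum_congr rfl fun p _ => hsum p ξ η h, Finset.sum_sub_distrib]
  simp only [Finset.sum_ite_eq', Finset.mem_univ, if_true]
  rcases lt_trichotomy (e (ρ ξ)) (e (ρ η)) with hlt | heq | hlt
  · rw [if_pos hlt, if_neg hlt.not_gt, sub_zero]
  · rw [heq, if_neg (lt_irrefl _), if_neg (lt_irrefl _), sub_zero]
    exact hsupp.1 ξ η h (not_passesThrough_of_agree hn (hρ.1 (e.injective heq)))
  · rw [if_neg hlt.not_gt, if_pos hlt, zero_sub, hanti ξ η h, neg_neg]
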